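/- The language of Dyck words (nonempty balanced bracket words) over the two-letter alphabet {u, d} with involution u* = d is a Pythagorean language. -/

import Mathlib

/-- The involution on words induced by an involution `s` on letters. -/
def wordStar {G : Type*} (s : G → G) (w : List G) : List G :=
  (w.map s).reverse

/-- A language is self-adjoint if it is closed under the word involution. -/
def IsSelfAdjointLang {G : Type*} (s : G → G) (L : Set (List G)) : Prop :=
  ∀ w ∈ L, wordStar s w ∈ L

/-- A self-adjoint language `L` is Pythagorean if for all nonempty words `α, β, γ`:
whenever `β*α` and `γ*α` lie in `L`, then `α*α` and `γ*β` lie in `L`. -/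
def IsPythagorean {G : Type*} (s : G → G) (L : Set (List G)) : Prop :=
  IsSelfAdjointLang s L ∧
    ∀ α β γ : List G, α ≠ [] → β ≠ [] → γ ≠ [] →
      wordStar s β ++ α ∈ L → wordStar s γ ++ α ∈ L →
      wordStar s α ++ α ∈ L ∧ wordStar s γ ++ β ∈ L

/-- The alphabet `{u, d}` is modeled by `Bool`, with `u = true`, `d = false`;
the involution `u* = d` is boolean negation. -/
def bstar : Bool → Bool := fun b => !b

/-- The height of a word: `u` counts `+1`, `d` counts `-1`. -/
def ht (w : List Bool) : ℤ :=
  (w.map (fun b => if b then (1 : ℤ) else -1)).sum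

/-- Dyck words: nonempty words of total height `0` all of whose prefixes have
height `≥ 0`. -/
def DyckLang : Set (List Bool) :=
  {w | w ≠ [] ∧ ht w = 0 ∧ ∀ p : List Bool, p <+: w → 0 ≤ ht p}

theorem ht_append (v w : List Bool) : ht (v ++ w) = ht v + ht w := by
  simp [ht]

theorem ht_wordStar (w : List Bool) : ht (wordStar bstar w) = -ht w := by
  induction w with
  | nil => simp [ht, wordStar]
  | cons b w ih =>
    cases b <;> simp_all [ht, wordStar, bstar]

theorem wordStar_append {G : Type*} (s : G → G) (v w : List G) :
    wordStar s (v ++ w) = wordStar s w ++ wordStar s v := by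
  simp [wordStar]

theorem wordStar_bstar_involutive : Function.Involutive (wordStar bstar) := fun w => by
  simp [wordStar, bstar, Function.comp_def]

/-- A word `β*α` is a Dyck word iff `α` and `β` have the same height and all suffixes of
`α` and of `β` have height `≤ 0`; this condition is symmetric in `α` and `β`. -/
theorem wordStar_append_mem_dyckLang_iff (α β : List Bool) :
    wordStar bstar β ++ α ∈ DyckLang ↔
      ¬(β = [] ∧ α = []) ∧ ht β = ht α ∧
        (∀ t, t <:+ β → ht t ≤ 0) ∧ ∀ t, t <:+ α → ht t ≤ 0 := by
  have hne : wordStar bstar β ++ α ≠ [] ↔ ¬(β = [] ∧ α = []) := by simp [wordStar]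
  change _ ∧ _ ∧ _ ↔ _
  rw [hne, ht_append, ht_wordStar]
  refine and_congr_right fun _ => ?_
  constructor
  · rintro ⟨h0, hp⟩
    refine ⟨by lia, ?_, ?_⟩
    · rintro t ⟨r, rfl⟩
      have := hp (wordStar bstar t) (by simp [wordStar_append])
      rw [ht_wordStar] at this
      lia
    · rintro t ⟨r, rfl⟩
      have := hp (wordStar bstar β ++ r) (by simp)
      simp only [ht_append, ht_wordStar] at this h0
      lia
  · rintro ⟨h0, hβ, hα⟩
    refine ⟨by lia, ?_⟩
    rintro p ⟨q, hq⟩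
    rcases List.append_eq_append_iff.1 hq with ⟨r, hr, -⟩ | ⟨r, rfl, rfl⟩
    · have hβ' : β = wordStar bstar r ++ wordStar bstar p := by
        rw [← wordStar_append, ← hr, wordStar_bstar_involutive]
      have := hβ (wordStar bstar p) ⟨_, hβ'.symm⟩
      rw [ht_wordStar] at this
      lia
    · have := hα q ⟨r, rfl⟩
      simp only [ht_append, ht_wordStar] at h0 ⊢
      lia

/-- The language of Dyck words is Pythagorean. -/
theorem dyck_isPythagorean : IsPythagorean bstar DyckLang := by
  refine ⟨fun w hw => ?_, fun α β γ hα hβ hγ h₁ h₂ => ?_⟩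
  · have h := (wordStar_append_mem_dyckLang_iff w []).1 (by simpa [wordStar] using hw)
    have h' := (wordStar_append_mem_dyckLang_iff [] w).2
      ⟨fun k => h.1 k.symm, h.2.1.symm, h.2.2.2, h.2.2.1⟩
    simpa using h'
  · rw [wordStar_append_mem_dyckLang_iff] at h₁ h₂
    obtain ⟨-, hβα, hsβ, hsα⟩ := h₁
    obtain ⟨-, hγα, hsγ, -⟩ := h₂
    exact ⟨(wordStar_append_mem_dyckLang_iff α α).2 ⟨fun k => hα k.1, rfl, hsα, hsα⟩,
      (wordStar_append_mem_dyckLang_iff β γ).2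
        ⟨fun k => hγ k.1, hγα.trans hβα.symm, hsγ, hsβ⟩⟩
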